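/- For every integer d ≥ 2 there exists a constant C > 0 such that for every odd prime power q and every E ⊆ F_q^d with |E| ≤ q^{(d+1)/2}, one has f(E) ≤ C|E|q^d. -/

import Mathlib

open Finset

/-- `degE E p r` is the number of points of `E` at distance `r` from `p`, where the
distance in `F_q^d` is `‖p − y‖ = ∑ i, (p i − y i)²`. -/
def degE {F : Type} [Field F] [DecidableEq F] {d : ℕ} (E : Finset (Fin d → F))
    (p : Fin d → F) (r : F) : ℕ :=
  (E.filter (fun y => ∑ i, (p i - y i) ^ 2 = r)).card

/-- `fE E = ∑_{r ∈ F_q*} ∑_{p ∈ E} deg_E(p,r)²` is the sum of the squared multiplicities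
of the nonzero distances determined by `E`. -/
def fE {F : Type} [Field F] [Fintype F] [DecidableEq F] {d : ℕ}
    (E : Finset (Fin d → F)) : ℕ :=
  ∑ r ∈ Finset.univ.filter (fun r : F => r ≠ 0), ∑ p ∈ E, (degE E p r) ^ 2

/-- The sum of the squared fibre sizes of `g` on `E` counts the pairs in `E` with equal values. -/
theorem sum_card_fiber_sq {α β : Type*} [Fintype β] [DecidableEq β] (E : Finset α)
    (g : α → β) :
    ∑ r, ((E.filter (fun y => g y = r)).card : ℝ) ^ 2
      = ∑ x ∈ E, ∑ y ∈ E, if g x = g y then (1 : ℝ) else 0 := by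
  have h : ∀ r, ((E.filter (fun y => g y = r)).card : ℝ) ^ 2
      = ∑ x ∈ E, ∑ y ∈ E, if g x = r then (if g y = r then (1 : ℝ) else 0) else 0 := by
    intro r
    rw [sq, Finset.card_filter]
    push_cast
    rw [Finset.sum_mul_sum]
    exact Finset.sum_congr rfl fun x _ => Finset.sum_congr rfl fun y _ => by
      rw [ite_mul, one_mul, zero_mul]
  simp_rw [h]
  rw [Finset.sum_comm]
  refine Finset.sum_congr rfl fun x _ => ?_
  rw [Finset.sum_comm]
  refine Finset.sum_congr rfl fun y _ => ?_
  simp [eq_comm]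

/-- In odd characteristic the perpendicular bisector of two distinct points of `F_q^d` has at
most `q^(d-1)` points. -/
theorem card_mul_card_bisector_le {F : Type} [Field F] [Fintype F] [DecidableEq F] {d : ℕ}
    (h2 : (2 : F) ≠ 0) {x y : Fin d → F} (hxy : x ≠ y) :
    (Finset.univ.filter
        (fun p : Fin d → F => ∑ i, (p i - x i) ^ 2 = ∑ i, (p i - y i) ^ 2)).card
      * Fintype.card F ≤ Fintype.card F ^ d := by
  obtain ⟨i, hi⟩ := Function.ne_iff.mp hxy
  have hlin : ∀ p : Fin d → F, ∑ j, (p j - x j) ^ 2 = ∑ j, (p j - y j) ^ 2 →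
      ∑ j, 2 * (y j - x j) * p j = ∑ j, (y j ^ 2 - x j ^ 2) := by
    intro p hp
    rw [← sub_eq_zero, ← Finset.sum_sub_distrib] at hp ⊢
    rw [← hp]
    exact Finset.sum_congr rfl fun j _ => by ring
  have hcard : Fintype.card F ^ d = (Finset.univ : Finset (Fin d → F)).card := by
    simp
  rw [hcard, ← Finset.card_univ (α := F), ← Finset.card_product]
  refine Finset.card_le_card_of_injOn (fun z => z.1 + Pi.single i z.2)
    (fun _ _ => Finset.mem_coe.2 (Finset.mem_univ _)) ?_
  rintro ⟨p, s⟩ hp ⟨p', t⟩ hp' h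
  simp only [Finset.coe_product, Set.mem_prod, Finset.mem_coe, Finset.mem_filter,
    Finset.mem_univ, true_and, and_true] at hp hp'
  have hsum : ∑ j, 2 * (y j - x j) * (p + Pi.single i s : Fin d → F) j
      = ∑ j, 2 * (y j - x j) * (p' + Pi.single i t : Fin d → F) j :=
    congrArg (fun v : Fin d → F => ∑ j, 2 * (y j - x j) * v j) h
  simp only [Pi.add_apply, mul_add, Finset.sum_add_distrib, hlin p hp, hlin p' hp',
    Pi.single_apply, mul_ite, mul_zero, Finset.sum_ite_eq', Finset.mem_univ, if_true,
    add_right_inj] at hsum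
  have hst : s = t := mul_left_cancel₀ (mul_ne_zero h2 (sub_ne_zero.2 (Ne.symm hi))) hsum
  subst hst
  simpa using h

/-- Over all of `F_q^d`, the pinned distance counts have second moment at most
`(|E|² q^d + |E| q^(d+1)) / q`. -/
theorem card_mul_sum_degE_sq_le {F : Type} [Field F] [Fintype F] [DecidableEq F] {d : ℕ}
    (h2 : (2 : F) ≠ 0) (E : Finset (Fin d → F)) :
    (∑ p, ∑ r, (degE E p r : ℝ) ^ 2) * Fintype.card F
      ≤ (E.card : ℝ) ^ 2 * (Fintype.card F : ℝ) ^ d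
        + E.card * (Fintype.card F : ℝ) ^ (d + 1) := by
  have hsq : ∀ p : Fin d → F, ∑ r, (degE E p r : ℝ) ^ 2 = ∑ x ∈ E, ∑ y ∈ E,
      if ∑ i, (p i - x i) ^ 2 = ∑ i, (p i - y i) ^ 2 then (1 : ℝ) else 0 := fun p =>
    sum_card_fiber_sq E fun y => ∑ i, (p i - y i) ^ 2
  simp_rw [hsq]
  rw [Finset.sum_comm, Finset.sum_mul]
  have hx : ∀ x ∈ E, (∑ p : Fin d → F, ∑ y ∈ E,
      if ∑ i, (p i - x i) ^ 2 = ∑ i, (p i - y i) ^ 2 then (1 : ℝ) else 0) * Fintype.card F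
      ≤ E.card * (Fintype.card F : ℝ) ^ d + (Fintype.card F : ℝ) ^ (d + 1) := by
    intro x hx
    rw [Finset.sum_comm, Finset.sum_mul]
    have hy : ∀ y ∈ E, (∑ p : Fin d → F,
        if ∑ i, (p i - x i) ^ 2 = ∑ i, (p i - y i) ^ 2 then (1 : ℝ) else 0) * Fintype.card F
        ≤ (Fintype.card F : ℝ) ^ d + if x = y then (Fintype.card F : ℝ) ^ (d + 1) else 0 := by
      intro y _
      by_cases hxy : x = y
      · subst hxy
        simp [pow_succ]
      · rw [if_neg hxy, add_zero, Finset.sum_boole]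
        exact_mod_cast card_mul_card_bisector_le h2 hxy
    refine (Finset.sum_le_sum hy).trans (le_of_eq ?_)
    rw [Finset.sum_add_distrib, Finset.sum_ite_eq, if_pos hx]
    simp
  refine (Finset.sum_le_sum hx).trans (le_of_eq ?_)
  rw [Finset.sum_const, nsmul_eq_mul]
  ring

theorem sum_degE {F : Type} [Field F] [Fintype F] [DecidableEq F] {d : ℕ}
    (E : Finset (Fin d → F)) (p : Fin d → F) : ∑ r, (degE E p r : ℝ) = E.card := by
  have h := Finset.card_eq_sum_card_fiberwise (s := E) (t := (Finset.univ : Finset F))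
    (f := fun y => ∑ i, (p i - y i) ^ 2) (fun _ _ => Finset.mem_coe.2 (Finset.mem_univ _))
  rw [h]
  push_cast
  rfl

theorem sum_degE_sub_sq {F : Type} [Field F] [Fintype F] [DecidableEq F] {d : ℕ}
    (E : Finset (Fin d → F)) (p : Fin d → F) :
    ∑ r, ((degE E p r : ℝ) - E.card / Fintype.card F) ^ 2
      = ∑ r, (degE E p r : ℝ) ^ 2 - (E.card : ℝ) ^ 2 / Fintype.card F := by
  have hq : (Fintype.card F : ℝ) ≠ 0 := by exact_mod_cast Fintype.card_ne_zero
  simp_rw [sub_sq]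
  rw [Finset.sum_add_distrib, Finset.sum_sub_distrib, ← Finset.sum_mul, ← Finset.mul_sum,
    sum_degE, Finset.sum_const, Finset.card_univ, nsmul_eq_mul]
  field_simp
  ring

/-- For every `d ≥ 2` there is a constant `C > 0` such that for every finite field `F_q`
of odd order and every `E ⊆ F_q^d` with `|E| ≤ q^{(d+1)/2}`, one has `f(E) ≤ C|E|q^d`. -/
theorem fE_small_sets (d : ℕ) (hd : 2 ≤ d) :
    ∃ C : ℝ, 0 < C ∧
      ∀ (F : Type) [Field F] [Fintype F] [DecidableEq F],
        Odd (Fintype.card F) →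
        ∀ E : Finset (Fin d → F),
          (E.card : ℝ) ≤ (Fintype.card F : ℝ) ^ (((d : ℝ) + 1) / 2) →
          (fE E : ℝ) ≤ C * (E.card : ℝ) * (Fintype.card F : ℝ) ^ d := by
  refine ⟨2, two_pos, ?_⟩
  intro F _ _ _ hodd E hE
  have h2 : (2 : F) ≠ 0 := by
    refine Ring.two_ne_zero fun hchar => ?_
    have := FiniteField.even_card_of_char_two hchar
    have := Nat.odd_iff.mp hodd
    omega
  have hmoment := card_mul_sum_degE_sq_le h2 E
  have hq : (0 : ℝ) < Fintype.card F := by exact_mod_cast Fintype.card_pos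
  have hsize : (E.card : ℝ) ^ 2 ≤ (Fintype.card F : ℝ) ^ d * Fintype.card F := by
    calc (E.card : ℝ) ^ 2 ≤ ((Fintype.card F : ℝ) ^ (((d : ℝ) + 1) / 2)) ^ 2 := by gcongr
      _ = (Fintype.card F : ℝ) ^ d * Fintype.card F := by
        rw [← Real.rpow_natCast, ← Real.rpow_mul hq.le, ← pow_succ, ← Real.rpow_natCast]
        congr 1
        push_cast
        ring
  have hvar : ∑ p, ∑ r, ((degE E p r : ℝ) - E.card / Fintype.card F) ^ 2
      ≤ E.card * (Fintype.card F : ℝ) ^ d := by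
    simp_rw [sum_degE_sub_sq]
    rw [Finset.sum_sub_distrib, Finset.sum_const, Finset.card_univ, nsmul_eq_mul]
    simp only [Fintype.card_pi, Finset.prod_const, Finset.card_univ, Fintype.card_fin]
    rw [← mul_le_mul_iff_left₀ hq, sub_mul]
    push_cast
    have : (Fintype.card F : ℝ) ^ d * ((E.card : ℝ) ^ 2 / Fintype.card F) * Fintype.card F
        = (Fintype.card F : ℝ) ^ d * (E.card : ℝ) ^ 2 := by
      field_simp
    rw [this]
    rw [pow_succ (Fintype.card F : ℝ) d] at hmoment
    linarith
  have hrestrict : ∑ p ∈ E, ∑ r, ((degE E p r : ℝ) - E.card / Fintype.card F) ^ 2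
      ≤ E.card * (Fintype.card F : ℝ) ^ d :=
    (Finset.sum_le_sum_of_subset_of_nonneg (Finset.subset_univ E)
      fun _ _ _ => Finset.sum_nonneg fun _ _ => sq_nonneg _).trans hvar
  simp_rw [sum_degE_sub_sq] at hrestrict
  rw [Finset.sum_sub_distrib, Finset.sum_const, nsmul_eq_mul] at hrestrict
  have hmean : (E.card : ℝ) * ((E.card : ℝ) ^ 2 / Fintype.card F)
      ≤ E.card * (Fintype.card F : ℝ) ^ d := by
    gcongr
    rwa [div_le_iff₀ hq]
  have hf : (fE E : ℝ) ≤ ∑ p ∈ E, ∑ r, (degE E p r : ℝ) ^ 2 := by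
    rw [Finset.sum_comm, fE]
    push_cast
    exact Finset.sum_le_sum_of_subset_of_nonneg (Finset.subset_univ _)
      fun _ _ _ => Finset.sum_nonneg fun _ _ => sq_nonneg _
  linarith
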